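/- For all v ∈ 𝕊^L one has ‖𝔞(ℛ·v)‖² ≤ (1 − ‖𝔠(v)‖²·γ/2)·‖𝔞(v)‖². -/

import Mathlib

open MeasureTheory ProbabilityTheory Matrix Real
open scoped ENNReal

noncomputable section

abbrev Sph (L : ℕ) := Metric.sphere (0 : EuclideanSpace ℝ (Fin (L+1))) 1

/-- The projective action `T · v = T v / ‖T v‖` on vectors. -/
noncomputable def act {n : ℕ} (T : Matrix (Fin n) (Fin n) ℝ)
    (v : EuclideanSpace ℝ (Fin n)) : EuclideanSpace ℝ (Fin n) :=
  ‖Matrix.toEuclideanLin T v‖⁻¹ • Matrix.toEuclideanLin T v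

/-- The projective action on the unit sphere (junk value `v` if `T v = 0`). -/
noncomputable def actS {L : ℕ} (T : Matrix (Fin (L+1)) (Fin (L+1)) ℝ) (v : Sph L) : Sph L :=
  if h : ‖Matrix.toEuclideanLin T (v : EuclideanSpace ℝ (Fin (L+1)))‖ = 0 then v
  else ⟨act T v, by
    rw [mem_sphere_zero_iff_norm, act, norm_smul, norm_inv, norm_norm, inv_mul_cancel₀ h]⟩

instance {m n α : Type*} [MeasurableSpace α] : MeasurableSpace (Matrix m n α) :=
  inferInstanceAs (MeasurableSpace (m → n → α))

/-- `U` is Haar distributed on the orthogonal group `O(L+1)`: it takes values in the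
orthogonal group and its law is invariant under left translation (which characterizes
the Haar probability measure on this compact group). -/
def IsHaarOrth {L : ℕ} {Ω : Type*} [MeasurableSpace Ω] (P : Measure Ω)
    (U : Ω → Matrix (Fin (L+1)) (Fin (L+1)) ℝ) : Prop :=
  Measurable U ∧ (∀ ω, U ω ∈ Matrix.orthogonalGroup (Fin (L+1)) ℝ) ∧
    ∀ O ∈ Matrix.orthogonalGroup (Fin (L+1)) ℝ,
      Measure.map (fun ω => O * U ω) P = Measure.map U P

/-- `ν` is the normalized rotation-invariant surface measure on the sphere: it is the unique
rotation-invariant Borel probability measure. -/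
def IsUniformSphere {L : ℕ} (ν : Measure (Sph L)) : Prop :=
  IsProbabilityMeasure ν ∧
    ∀ O ∈ Matrix.orthogonalGroup (Fin (L+1)) ℝ, Measure.map (actS O) ν = ν

/-- Topological support of a measure. -/
def msupport {X : Type*} [TopologicalSpace X] [MeasurableSpace X] (μ : Measure X) : Set X :=
  {x | ∀ s : Set X, IsOpen s → x ∈ s → 0 < μ s}

/-- `‖𝔞(v)‖²`, the squared norm of the first `La` components. -/
noncomputable def naSq {n : ℕ} (La : ℕ) (v : EuclideanSpace ℝ (Fin n)) : ℝ :=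
  ∑ k : Fin n, if (k : ℕ) < La then (v k)^2 else 0

/-- `‖𝔠(v)‖²`, the squared norm of the components with index `> La + Lb`. -/
noncomputable def ncSq {n : ℕ} (Lab : ℕ) (v : EuclideanSpace ℝ (Fin n)) : ℝ :=
  ∑ k : Fin n, if Lab ≤ (k : ℕ) then (v k)^2 else 0

/-- Ordered application of the (random) matrices `M 0, …, M (N-1)` to `v`. -/
noncomputable def chainW {L : ℕ} {Ω : Type*}
    (M : ℕ → Ω → Matrix (Fin (L+1)) (Fin (L+1)) ℝ) :
    ℕ → Ω → Sph L → Sph L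
  | 0, _, v => v
  | (n+1), ω, v => actS (M n ω) (chainW M n ω v)

/-- Ordered application of the matrices `M 0, …, M (N-1)` to `v` (deterministic). -/
noncomputable def chainD {L : ℕ} (M : ℕ → Matrix (Fin (L+1)) (Fin (L+1)) ℝ) :
    ℕ → Sph L → Sph L
  | 0, v => v
  | (n+1), v => actS (M n) (chainD M n v)
/-- The elementary inequality behind the contraction estimate: `a` and `r` are the unnormalized
contributions of the first block and of its complement. -/
theorem contraction_of_block_bounds {a r m A x : ℝ} (hA0 : 0 ≤ A) (hA1 : A ≤ 1)
    (hx0 : 0 ≤ x) (hx1 : x ≤ 1) (hm : 0 ≤ m) (ha : a ≤ m * A) (hr : m * (1 - A) + m * x ≤ r) :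
    a ≤ (1 - x / 2) * A * (a + r) := by
  have hcoef : (1 - x / 2) * A ≤ 1 := by nlinarith [mul_nonneg hx0 hA0]
  have hnn : 0 ≤ (1 - x / 2) * A := mul_nonneg (by linarith) hA0
  have h1 := mul_le_mul_of_nonneg_left hr hnn
  have h2 := mul_le_mul_of_nonneg_left ha (sub_nonneg.2 hcoef)
  have h3 : 0 ≤ m * A * (x * (1 - x)) :=
    mul_nonneg (mul_nonneg hm hA0) (mul_nonneg hx0 (by linarith))
  nlinarith

theorem toEuclideanLin_diagonal_apply {n : ℕ} (d : Fin n → ℝ) (v : EuclideanSpace ℝ (Fin n))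
    (k : Fin n) : Matrix.toEuclideanLin (Matrix.diagonal d) v k = d k * v k := by
  simp [Matrix.toLpLin_apply, Matrix.mulVec_diagonal]

theorem naSq_smul {n : ℕ} (La : ℕ) (c : ℝ) (v : EuclideanSpace ℝ (Fin n)) :
    naSq La (c • v) = c ^ 2 * naSq La v := by
  simp only [naSq, Finset.mul_sum, PiLp.smul_apply, smul_eq_mul, mul_ite, mul_zero, mul_pow]

theorem naSq_nonneg {n : ℕ} (La : ℕ) (v : EuclideanSpace ℝ (Fin n)) : 0 ≤ naSq La v :=
  Finset.sum_nonneg fun k _ => by split_ifs <;> positivity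

theorem ncSq_nonneg {n : ℕ} (Lab : ℕ) (v : EuclideanSpace ℝ (Fin n)) : 0 ≤ ncSq Lab v :=
  Finset.sum_nonneg fun k _ => by split_ifs <;> positivity

theorem naSq_le_norm_sq {n : ℕ} (La : ℕ) (v : EuclideanSpace ℝ (Fin n)) :
    naSq La v ≤ ‖v‖ ^ 2 := by
  rw [EuclideanSpace.real_norm_sq_eq]
  exact Finset.sum_le_sum fun k _ => by split_ifs <;> [exact le_rfl; positivity]

theorem ncSq_le_norm_sq {n : ℕ} (Lab : ℕ) (v : EuclideanSpace ℝ (Fin n)) :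
    ncSq Lab v ≤ ‖v‖ ^ 2 := by
  rw [EuclideanSpace.real_norm_sq_eq]
  exact Finset.sum_le_sum fun k _ => by split_ifs <;> [exact le_rfl; positivity]

/-- A linear map stretching the first block by at most `q`, everything else by at least `q` and the
last block by at least `p`. -/
theorem block_bounds_diagonal {n : ℕ} {La Lab : ℕ} (hLab : La ≤ Lab) {d : Fin n → ℝ} {p q : ℝ}
    (hd : ∀ k, 0 ≤ d k) (hq : 0 ≤ q) (hp : 0 ≤ p)
    (hda : ∀ k : Fin n, (k : ℕ) < La → d k ≤ q) (hdb : ∀ k : Fin n, La ≤ (k : ℕ) → q ≤ d k)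
    (hdc : ∀ k : Fin n, Lab ≤ (k : ℕ) → p ≤ d k) (v : EuclideanSpace ℝ (Fin n)) :
    naSq La (Matrix.toEuclideanLin (Matrix.diagonal d) v) ≤ q ^ 2 * naSq La v ∧
      q ^ 2 * (‖v‖ ^ 2 - naSq La v) + (p ^ 2 - q ^ 2) * ncSq Lab v ≤
        ‖Matrix.toEuclideanLin (Matrix.diagonal d) v‖ ^ 2
          - naSq La (Matrix.toEuclideanLin (Matrix.diagonal d) v) := by
  constructor
  · simp only [naSq, Finset.mul_sum, toEuclideanLin_diagonal_apply]
    refine Finset.sum_le_sum fun k _ => ?_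
    split_ifs with h
    · rw [mul_pow]
      have := hd k
      gcongr
      exact hda k h
    · simp
  · simp only [EuclideanSpace.real_norm_sq_eq, naSq, ncSq, ← Finset.sum_sub_distrib,
      Finset.mul_sum, ← Finset.sum_add_distrib, toEuclideanLin_diagonal_apply]
    refine Finset.sum_le_sum fun k _ => ?_
    by_cases h : (k : ℕ) < La
    · simp [h, (h.trans_le hLab).not_ge]
    · have hb := pow_le_pow_left₀ hq (hdb k (not_lt.1 h)) 2
      have hv := sq_nonneg (v k)
      by_cases h' : Lab ≤ (k : ℕ)
      · have hc := pow_le_pow_left₀ hp (hdc k h') 2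
        simp only [h, h', if_true, if_false]
        nlinarith
      · simp only [h, h', if_false]
        nlinarith

theorem coe_actS_of_ne_zero {L : ℕ} {T : Matrix (Fin (L+1)) (Fin (L+1)) ℝ} {v : Sph L}
    (h : ‖Matrix.toEuclideanLin T (v : EuclideanSpace ℝ (Fin (L+1)))‖ ≠ 0) :
    (actS T v : EuclideanSpace ℝ (Fin (L+1))) = act T v := by
  rw [actS, dif_neg h]

theorem toEuclideanLin_diagonal_ne_zero {n : ℕ} {d : Fin n → ℝ} (hd : ∀ k, d k ≠ 0)
    {v : EuclideanSpace ℝ (Fin n)} (hv : v ≠ 0) :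
    Matrix.toEuclideanLin (Matrix.diagonal d) v ≠ 0 := by
  contrapose! hv
  ext k
  have := toEuclideanLin_diagonal_apply d v k
  rw [hv] at this
  simpa [hd k] using this.symm

theorem stmt12 {L : ℕ} (hL : 2 ≤ L)
    (κ : ℕ → ℝ) (hκpos : ∀ i, 1 ≤ i → i ≤ L+1 → 0 < κ i)
    (hκmono : ∀ i j, 1 ≤ i → i ≤ j → j ≤ L+1 → κ j ≤ κ i)
    (R : Matrix (Fin (L+1)) (Fin (L+1)) ℝ)
    (hR : R = Matrix.diagonal fun k : Fin (L+1) => κ (L+1-(k:ℕ)))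
    (La Lb Lc : ℕ) (hLa : 1 ≤ La) (hLb : 1 ≤ Lb) (hLc : 1 ≤ Lc)
    (hsum : La + Lb + Lc = L + 1)
    (γ : ℝ) (hγdef : γ = min 1 ((κ Lc)^2 / (κ (Lb+Lc+1))^2 - 1)) :
    ∀ v : Sph L,
      naSq La ((actS R v : Sph L) : EuclideanSpace ℝ (Fin (L+1)))
        ≤ (1 - ncSq (La+Lb) (v : EuclideanSpace ℝ (Fin (L+1))) * (γ/2))
            * naSq La (v : EuclideanSpace ℝ (Fin (L+1))) := by
  intro v
  subst hR hγdef
  have hq : 0 < κ (Lb+Lc+1) := hκpos _ (by omega) (by omega)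
  have hp : 0 < κ Lc := hκpos _ hLc (by omega)
  have hqp : κ (Lb+Lc+1) ≤ κ Lc := hκmono _ _ hLc (by omega) (by omega)
  set p := κ Lc
  set q := κ (Lb+Lc+1)
  have hd : ∀ k : Fin (L+1), 0 < κ (L+1-(k:ℕ)) := fun k => hκpos _ (by omega) (by omega)
  have hv : ‖(v : EuclideanSpace ℝ (Fin (L+1)))‖ = 1 := mem_sphere_zero_iff_norm.1 v.2
  obtain ⟨ha, hr⟩ := block_bounds_diagonal (La := La) (Lab := La+Lb) (by omega)
    (d := fun k : Fin (L+1) => κ (L+1-(k:ℕ))) (p := p) (q := q) (fun k => (hd k).le) hq.le hp.le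
    (fun k hk => hκmono _ _ (by omega) (by omega) (by omega))
    (fun k hk => hκmono _ _ (by omega) (by omega) (by omega))
    (fun k hk => hκmono _ _ (by omega) (by omega) (by omega))
    (v : EuclideanSpace ℝ (Fin (L+1)))
  have hA := naSq_le_norm_sq La (v : EuclideanSpace ℝ (Fin (L+1)))
  have hC := ncSq_le_norm_sq (La+Lb) (v : EuclideanSpace ℝ (Fin (L+1)))
  have hC0 := ncSq_nonneg (La+Lb) (v : EuclideanSpace ℝ (Fin (L+1)))
  have hne : ‖Matrix.toEuclideanLin (Matrix.diagonal fun k : Fin (L+1) => κ (L+1-(k:ℕ)))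
      (v : EuclideanSpace ℝ (Fin (L+1)))‖ ≠ 0 :=
    norm_ne_zero_iff.2 <| toEuclideanLin_diagonal_ne_zero (fun k => (hd k).ne')
      (norm_ne_zero_iff.1 (by rw [hv]; exact one_ne_zero))
  rw [hv, one_pow] at hA hC hr
  have hratio : 1 ≤ p ^ 2 / q ^ 2 := by
    rw [one_le_div (by positivity)]
    gcongr
  set γ := min 1 (p ^ 2 / q ^ 2 - 1)
  have hγ0 : 0 ≤ γ := le_min zero_le_one (by linarith)
  have hγ1 : γ ≤ 1 := min_le_left _ _
  have hγ : q ^ 2 * γ ≤ p ^ 2 - q ^ 2 := by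
    calc q ^ 2 * γ ≤ q ^ 2 * (p ^ 2 / q ^ 2 - 1) := by gcongr; exact min_le_right _ _
      _ = p ^ 2 - q ^ 2 := by field_simp
  have key := contraction_of_block_bounds (naSq_nonneg La (v : EuclideanSpace ℝ (Fin (L+1)))) hA
    (mul_nonneg hγ0 hC0) (mul_le_one₀ hγ1 hC0 hC) (sq_nonneg q) ha
    (le_trans (by nlinarith) hr)
  rw [coe_actS_of_ne_zero hne, act, naSq_smul, inv_pow, inv_mul_le_iff₀ (by positivity)]
  linarith
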